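/- There does not exist a BH(8,15) matrix; that is, there is no 8×8 complex matrix H all of whose entries are 15th roots of unity satisfying H·H* = 8·I_8. -/

import Mathlib

open Matrix

/-- A Butson-type complex Hadamard matrix of complexity `q`: every entry is a complex
`q`-th root of unity and `H * Hᴴ = n • I` where `n` is the size of the matrix. -/
def IsButson {m : Type*} [Fintype m] [DecidableEq m] (q : ℕ) (H : Matrix m m ℂ) : Prop :=
  (∀ i j, H i j ^ q = 1) ∧ H * H.conjTranspose = (Fintype.card m : ℂ) • 1

/-- Evaluation of the fifteenth cyclotomic polynomial at a primitive root. -/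
lemma pow_eight_of_isPrimitiveRoot {ζ : ℂ} (h : IsPrimitiveRoot ζ 15) :
    ζ ^ 8 = ζ ^ 7 - ζ ^ 5 + ζ ^ 4 - ζ ^ 3 + ζ - 1 := by
  have h5 : ζ ^ 5 - 1 ≠ 0 := sub_ne_zero.2 (h.pow_ne_one_of_pos_of_lt (by norm_num) (by norm_num))
  have h3 : ζ ^ 3 - 1 ≠ 0 := sub_ne_zero.2 (h.pow_ne_one_of_pos_of_lt (by norm_num) (by norm_num))
  have h2 : ζ ^ 2 + ζ + 1 ≠ 0 := fun h0 => h3 (by linear_combination (ζ - 1) * h0)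
  have h15 := h.pow_eq_one
  have key : (ζ ^ 5 - 1) * ((ζ ^ 2 + ζ + 1) *
      (ζ ^ 8 - (ζ ^ 7 - ζ ^ 5 + ζ ^ 4 - ζ ^ 3 + ζ - 1))) = 0 := by
    linear_combination h15
  rcases mul_eq_zero.1 key with h0 | h0
  · exact absurd h0 h5
  rcases mul_eq_zero.1 h0 with h0 | h0
  · exact absurd h0 h2
  · exact sub_eq_zero.1 h0

/-- The powers `1, ζ, …, ζ ^ 7` of a primitive fifteenth root of unity are independent over `ℤ`. -/
lemma coeff_eq_zero_of_isPrimitiveRoot {ζ : ℂ} (h : IsPrimitiveRoot ζ 15) (c : Fin 8 → ℤ)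
    (hc : ∑ i, (c i : ℂ) * ζ ^ (i : ℕ) = 0) (i : Fin 8) : c i = 0 := by
  have hdeg : (minpoly ℚ ζ).natDegree = 8 := by
    rw [← Polynomial.cyclotomic_eq_minpoly_rat h (by norm_num), Polynomial.natDegree_cyclotomic]
    decide
  have hli := linearIndependent_pow (K := ℚ) ζ
  rw [hdeg] at hli
  have := Fintype.linearIndependent_iff.1 hli (fun i => (c i : ℚ))
    (by simpa [Algebra.smul_def] using hc) i
  exact_mod_cast this

/-- A vanishing `ℤ`-combination of fifteenth roots of unity has, as a function on
`ZMod 3 × ZMod 5`, no mixed second differences. -/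
lemma add_eq_add_of_sum_eq_zero {ζ : ℂ} (h : IsPrimitiveRoot ζ 15) (N : ZMod 15 → ℕ)
    (hN : ∑ z, (N z : ℂ) * ζ ^ z.val = 0) (u : ZMod 3) (v : ZMod 5) :
    N (10 * u.val + 6 * v.val) + N 0 = N (10 * u.val) + N (6 * v.val) := by
  have h8 := pow_eight_of_isPrimitiveRoot h
  have hsum : (N 0 : ℂ) + N 1 * ζ + N 2 * ζ ^ 2 + N 3 * ζ ^ 3 + N 4 * ζ ^ 4 + N 5 * ζ ^ 5
      + N 6 * ζ ^ 6 + N 7 * ζ ^ 7 + N 8 * ζ ^ 8 + N 9 * ζ ^ 9 + N 10 * ζ ^ 10 + N 11 * ζ ^ 11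
      + N 12 * ζ ^ 12 + N 13 * ζ ^ 13 + N 14 * ζ ^ 14 = 0 := by
    rw [← hN]
    change _ = ∑ z : Fin 15, (N z : ℂ) * ζ ^ (z : ℕ)
    simp only [Fin.sum_univ_succ, Fin.sum_univ_zero]
    simp [← add_assoc]
    rfl
  have hc := coeff_eq_zero_of_isPrimitiveRoot h
    ![N 0 - N 8 - N 9 - N 10 + N 13 + N 14, N 1 + N 8 - N 11 - N 13,
      N 2 + N 9 - N 12 - N 14, N 3 - N 8 - N 9 + N 14, N 4 + N 8 - N 13 - N 14,
      N 5 - N 8 - N 10 + N 13, N 6 - N 9 - N 11 + N 14, N 7 + N 8 + N 9 - N 12 - N 13 - N 14] (by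
    simp [Fin.sum_univ_succ]
    rw [← hsum]
    have h9 : ζ ^ 9 = ζ ^ 7 - ζ ^ 6 - ζ ^ 3 + ζ ^ 2 - 1 := by linear_combination (ζ + 1) * h8
    have h10 : ζ ^ 10 = - ζ ^ 5 - 1 := by linear_combination ζ * h9 + h8
    rw [show ζ ^ 11 = ζ * ζ ^ 10 by ring, show ζ ^ 12 = ζ ^ 2 * ζ ^ 10 by ring,
      show ζ ^ 13 = ζ ^ 3 * ζ ^ 10 by ring, show ζ ^ 14 = ζ ^ 4 * ζ ^ 10 by ring, h10]
    linear_combination (-(N 8 : ℂ) + N 13) * h8 + (-(N 9 : ℂ) + N 14) * h9)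
  have c0 := hc 0
  have c1 := hc 1
  have c2 := hc 2
  have c3 := hc 3
  have c4 := hc 4
  have c5 := hc 5
  have c6 := hc 6
  have c7 := hc 7
  simp at c0 c1 c2 c3 c4 c5 c6 c7
  have hu : u.val < 3 := u.val_lt
  have hv : v.val < 5 := v.val_lt
  generalize u.val = a at *
  generalize v.val = b at *
  interval_cases a <;> interval_cases b <;> norm_num <;> reduce_mod_char <;> omega

/-- If `M u v` has no mixed second differences on `ZMod 3 × ZMod 5`, takes values in `ℕ` and has total
mass `8`, it is the sum of an indicator function of `u` and one of `v`. -/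
lemma exists_indicators (M : ZMod 3 → ZMod 5 → ℕ)
    (hM : ∀ u v, M u v + M 0 0 = M u 0 + M 0 v) (h8 : ∑ u, ∑ v, M u v = 8) :
    ∃ b a, ∀ u v, M u v = (if u = b then 1 else 0) + (if v = a then 1 else 0) := by
  obtain ⟨w, hw⟩ := Finite.exists_min (fun u => M u 0)
  have hsplit : ∀ u v, M u v = (M u 0 - M w 0) + M w v := fun u v => by
    have h1 := hM u v
    have h2 := hM w v
    have h3 := hw u
    omega
  generalize hA : (fun u => M u 0 - M w 0) = A at *
  generalize hB : M w = B at *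
  replace hsplit : ∀ u v, M u v = A u + B v := fun u v => by rw [hsplit, ← hA]
  have hs : 5 * ∑ u, A u + 3 * ∑ v, B v = 8 := by
    rw [← h8]
    simp only [hsplit, Finset.sum_add_distrib, Finset.sum_const, Finset.card_univ, ZMod.card,
      smul_eq_mul, Finset.mul_sum]
  have hA1 : ∑ u, A u = 1 := by omega
  have hB1 : ∑ v, B v = 1 := by omega
  have ind : ∀ {ι : Type} [Fintype ι] [DecidableEq ι] (f : ι → ℕ), ∑ i, f i = 1 →
      ∃ b, ∀ i, f i = if i = b then 1 else 0 := by
    intro ι _ _ f hf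
    obtain ⟨b, -, hb⟩ := Finset.exists_ne_zero_of_sum_ne_zero (by omega : ∑ i, f i ≠ 0)
    refine ⟨b, fun i => ?_⟩
    have h1 := Finset.add_sum_erase Finset.univ f (Finset.mem_univ b)
    split_ifs with hi
    · subst hi; omega
    · have := Finset.single_le_sum (f := f) (fun _ _ => Nat.zero_le _)
        (Finset.mem_erase.2 ⟨hi, Finset.mem_univ i⟩)
      omega
  obtain ⟨b, hb⟩ := ind A hA1
  obtain ⟨a, ha⟩ := ind B hB1
  exact ⟨b, a, fun u v => by rw [hsplit, hb, ha]⟩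

/-- The combinatorial shape of the exponents in a vanishing sum of eight fifteenth roots of unity,
with the exponents split as elements of `ZMod 3` and of `ZMod 5`. -/
structure IsTripleQuintuple (x : Fin 8 → ZMod 3) (y : Fin 8 → ZMod 5) (b : ZMod 3) (a : ZMod 5)
    (p q : Fin 8) : Prop where
  ne : p ≠ q
  x_eq : ∀ l, x l = b + (if l = p then 1 else 0) - (if l = q then 1 else 0)
  y_left : y p = a
  y_right : y q = a
  card_eq : (Finset.univ.filter fun l => y l = a).card = 4
  card_ne : ∀ c, c ≠ a → (Finset.univ.filter fun l => y l = c).card = 1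

lemma exists_isTripleQuintuple (x : Fin 8 → ZMod 3) (y : Fin 8 → ZMod 5)
    (hM : ∀ u v, (Finset.univ.filter fun l => x l = u ∧ y l = v).card +
        (Finset.univ.filter fun l => x l = 0 ∧ y l = 0).card =
      (Finset.univ.filter fun l => x l = u ∧ y l = 0).card +
        (Finset.univ.filter fun l => x l = 0 ∧ y l = v).card) :
    ∃ b a p q, IsTripleQuintuple x y b a p q := by
  have hy : ∀ v, (Finset.univ.filter fun l => y l = v).card =
      ∑ u, (Finset.univ.filter fun l => x l = u ∧ y l = v).card := fun v => by
    rw [Finset.card_eq_sum_card_fiberwise (f := x) (t := Finset.univ) (by simp)]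
    simp only [Finset.filter_filter, and_comm]
  obtain ⟨b, a, h⟩ := exists_indicators
    (fun u v => (Finset.univ.filter fun l => x l = u ∧ y l = v).card) hM (by
      rw [Finset.sum_comm]
      simp only [← hy]
      rw [← Finset.card_eq_sum_card_fiberwise (f := y) (t := Finset.univ) (by simp)]
      simp)
  have hb1 : b + 1 ≠ b := by clear h; revert b; decide
  have hb2 : b - 1 ≠ b := by clear h hb1; revert b; decide
  have hb3 : ∀ t : ZMod 3, t = b ∨ t = b + 1 ∨ t = b - 1 := by clear h hb1 hb2; revert b; decide
  have hyc : ∀ v, (Finset.univ.filter fun l => y l = v).card = 1 + 3 * if v = a then 1 else 0 := by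
    intro v
    rw [hy]
    simp [h, Finset.sum_add_distrib]
  have uniq : ∀ u, u ≠ b → ∃ p, ∀ l, (x l = u → l = p) ∧ x p = u ∧ y p = a := by
    intro u hu
    obtain ⟨p, hp⟩ := Finset.card_eq_one.1 (show
      (Finset.univ.filter fun l => x l = u ∧ y l = a).card = 1 by simp [h, hu])
    have hmem : ∀ l, (x l = u ∧ y l = a) ↔ l = p := fun l => by
      simpa using Finset.ext_iff.1 hp l
    refine ⟨p, fun l => ⟨fun hl => (hmem l).1 ⟨hl, ?_⟩, (hmem p).2 rfl⟩⟩
    by_contra hne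
    have h0 : (Finset.univ.filter fun l' => x l' = u ∧ y l' = y l).card = 0 := by simp [h, hu, hne]
    have := Finset.eq_empty_iff_forall_notMem.1 (Finset.card_eq_zero.1 h0) l
    simp [hl] at this
  obtain ⟨p, hp⟩ := uniq _ hb1
  obtain ⟨q, hq⟩ := uniq _ hb2
  have hpq : p ≠ q := by
    rintro rfl
    have := (hp p).2.1.symm.trans (hq p).2.1
    clear h hb1 hb2 hb3 hp hq uniq
    revert this; revert b; decide
  refine ⟨b, a, p, q, hpq, fun l => ?_, (hp p).2.2, (hq q).2.2, by simp [hyc],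
    fun c hc => by simp [hyc, hc]⟩
  by_cases hlp : l = p
  · subst hlp; simp [(hp l).2.1, hpq]
  by_cases hlq : l = q
  · subst hlq; simp [(hq l).2.1, hlp]
  rcases hb3 (x l) with h0 | h0 | h0
  · simp [h0, hlp, hlq]
  · exact absurd ((hp l).1 h0) hlp
  · exact absurd ((hq l).1 h0) hlq

/-- Differences of distinct vectors `e_p - e_q` over `ZMod 3` are again of this form, up to a
constant, only if the two vectors share a tail or a head or are opposite. -/
lemma share_of_difference {p q p' q' r s : Fin 8} {b c : ZMod 3} (hpq : p ≠ q) (hpq' : p' ≠ q')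
    (hrs : r ≠ s)
    (h : ∀ l, c + (if l = p then 1 else 0) - (if l = q then 1 else 0) -
      ((if l = p' then 1 else 0) - (if l = q' then 1 else 0)) =
      b + (if l = r then 1 else 0) - (if l = s then (1 : ZMod 3) else 0)) :
    (p = p' ∧ q ≠ q') ∨ (p ≠ p' ∧ q = q') ∨ (p = q' ∧ q = p') := by
  obtain ⟨t, ht⟩ : ∃ t, t ∉ ({p, q, p', q', r, s} : Finset (Fin 8)) := by
    by_contra! hall
    have h1 := Finset.card_le_card (fun t _ => hall t : (Finset.univ : Finset (Fin 8)) ⊆ _)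
    have h2 := Finset.card_le_six (a := p) (b := q) (c := p') (d := q') (e := r) (f := s)
    simp at h1
    omega
  simp only [Finset.mem_insert, Finset.mem_singleton, not_or] at ht
  have hcb : c = b := by simpa [ht] using h t
  subst hcb
  have one_ne : (1 : ZMod 3) ≠ -1 := by decide
  have pos : ∀ l, (if l = r then 1 else 0) - (if l = s then (1 : ZMod 3) else 0) = 1 → l = r := by
    intro l hl
    by_contra hne
    by_cases hls : l = s
    · simp [hls, hrs.symm] at hl
      exact one_ne hl.symm
    · simp [hne, hls] at hl
  have neg : ∀ l, (if l = r then 1 else 0) - (if l = s then (1 : ZMod 3) else 0) = -1 → l = s := by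
    intro l hl
    by_contra hne
    by_cases hlr : l = r
    · simp [hlr, hrs] at hl
      exact one_ne hl
    · simp [hne, hlr] at hl
  replace h : ∀ l, (if l = p then 1 else 0) - (if l = q then 1 else 0) -
      ((if l = p' then 1 else 0) - (if l = q' then 1 else 0)) =
      (if l = r then 1 else 0) - (if l = s then (1 : ZMod 3) else 0) := fun l => by
    linear_combination h l
  by_cases hp : p = p'
  · by_cases hq : q = q'
    · have := h r
      simp [hp, hq, hrs] at this
    · exact .inl ⟨hp, hq⟩
  by_cases hq : q = q'
  · exact .inr (.inl ⟨hp, hq⟩)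
  by_cases h1 : p = q'
  · by_cases h2 : q = p'
    · exact .inr (.inr ⟨h1, h2⟩)
    · have a1 := neg q (by rw [← h]; simp [hpq.symm, hq, h2])
      have a2 := neg p' (by rw [← h]; simp [hpq', Ne.symm h2, Ne.symm hp])
      exact absurd (a1.trans a2.symm) h2
  · have a1 := pos p (by rw [← h]; simp [hpq, hp, h1])
    have a2 := pos q' (by rw [← h]; simp [hpq'.symm, Ne.symm hq, Ne.symm h1])
    exact absurd (a1.trans a2.symm) h1

/-- There is no `8 × 8` array over `ZMod 5` whose `j`-th and `k`-th rows, `j ≠ k`, differ by the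
same amount in columns `j` and `k`, by that amount in exactly four columns, and by any other amount
in exactly one column. -/
lemma no_array (y : Fin 8 → Fin 8 → ZMod 5)
    (h : ∀ j k, j ≠ k → ∃ a, y j j - y k j = a ∧ y j k - y k k = a ∧
      (Finset.univ.filter fun l => y j l - y k l = a).card = 4 ∧
      ∀ c, c ≠ a → (Finset.univ.filter fun l => y j l - y k l = c).card = 1) : False := by
  obtain ⟨d, hd⟩ : ∃ d : Fin 8 → Fin 8 → ZMod 5, ∀ j k, d j k = y j k - y k k := ⟨_, fun _ _ => rfl⟩
  have hdiff : ∀ j k l, y j l - y k l = d j l - d k l := fun j k l => by rw [hd, hd]; ring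
  have hself : ∀ j, d j j = 0 := fun j => by rw [hd]; ring
  have hskew : ∀ j k, d k j = - d j k := fun j k => by
    by_cases hjk : j = k
    · subst hjk; simp [hself]
    obtain ⟨a, h1, h2, -⟩ := h j k hjk
    rw [hd, hd]
    linear_combination -h1 + h2
  have hfour : ∀ j k, j ≠ k →
      (Finset.univ.filter fun l => d j l - d k l = d j k).card = 4 := fun j k hjk => by
    obtain ⟨a, h1, h2, h3, -⟩ := h j k hjk
    simp only [← hdiff]
    rw [hd, h2, h3]
  have hone : ∀ j k, j ≠ k → ∀ c, c ≠ d j k →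
      (Finset.univ.filter fun l => d j l - d k l = c).card = 1 := fun j k hjk c hc => by
    obtain ⟨a, h1, h2, -, h4⟩ := h j k hjk
    simp only [← hdiff]
    rw [hd, h2] at hc
    exact h4 c hc
  let C : Fin 8 → Finset (Fin 8) := fun j =>
    Finset.univ.filter fun k => k ≠ 0 ∧ d j k = d 0 k - d 0 j
  have hC : ∀ j k, k ∈ C j ↔ k ≠ 0 ∧ d j k = d 0 k - d 0 j := fun j k => by simp [C]
  have hcard : ∀ j, j ≠ 0 → (C j).card = 3 := fun j hj => by
    have h0 : C j = (Finset.univ.filter fun l => d j l - d 0 l = d j 0).erase 0 := by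
      ext l
      simp only [hC, Finset.mem_erase, Finset.mem_filter, Finset.mem_univ, true_and, hskew 0 j]
      refine and_congr_right fun _ => ⟨fun h => ?_, fun h => ?_⟩
      · linear_combination h
      · linear_combination h
    rw [h0, Finset.card_erase_of_mem (by simp [hself]), hfour j 0 hj]
  have hsymm : ∀ j k, j ≠ 0 → k ∈ C j → j ∈ C k := fun j k hj hk => by
    rw [hC] at *
    refine ⟨hj, ?_⟩
    rw [hskew j k, hk.2]
    ring
  have htrans : ∀ j l k, j ≠ 0 → k ≠ 0 → l ∈ C j → l ∈ C k → k ∈ C j := fun j l k hj hk h1 h2 => by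
    rw [hC] at *
    refine ⟨hk, ?_⟩
    by_cases hjk : j = k
    · subst hjk; simp [hself]
    by_contra hne
    have hcd := hone j k hjk _ (Ne.symm hne)
    have := Finset.card_le_one.1 hcd.le 0 (by
        simp only [Finset.mem_filter, Finset.mem_univ, true_and, hskew 0]
        ring) l
      (by
        simp only [Finset.mem_filter, Finset.mem_univ, true_and]
        linear_combination h1.2 - h2.2)
    exact h1.1 this.symm
  have hmem : ∀ j, j ≠ 0 → j ∈ C j := fun j hj => by simp [hC, hj, hself]
  have hsum := Finset.card_eq_sum_card_image C (Finset.univ.erase (0 : Fin 8))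
  rw [Finset.sum_congr rfl (g := fun _ => 3), Finset.sum_const] at hsum
  · simp at hsum
    omega
  intro S hS
  obtain ⟨j, hj, rfl⟩ := Finset.mem_image.1 hS
  have hj0 : j ≠ 0 := (Finset.mem_erase.1 hj).1
  rw [← hcard j hj0]
  congr 1
  ext k
  simp only [Finset.mem_filter, Finset.mem_erase, Finset.mem_univ, and_true]
  constructor
  · rintro ⟨hk, he⟩
    rw [← he]
    exact hmem k hk
  · intro hk
    have hk0 := ((hC j k).1 hk).1
    refine ⟨hk0, ?_⟩
    ext l
    constructor
    · intro hl
      have hl0 := ((hC k l).1 hl).1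
      exact htrans j k l hj0 hl0 hk (hsymm k l hk0 hl)
    · intro hl
      have hl0 := ((hC j l).1 hl).1
      exact htrans k j l hk0 hl0 (hsymm j k hj0 hk) (hsymm j l hj0 hl)

/-- Eight vectors over `ZMod 3` whose pairwise differences are all of the form `e_p - e_q` up to a
constant are, up to a common translation and constants, plus or minus the standard basis. -/
lemma exists_star (x : Fin 8 → Fin 8 → ZMod 3)
    (h : ∀ i k, i ≠ k → ∃ b p q, p ≠ q ∧ ∀ l, x i l - x k l =
      b + (if l = p then 1 else 0) - (if l = q then 1 else 0)) :
    ∃ (σ : Fin 8 → Fin 8) (s : ZMod 3) (b c : Fin 8 → ZMod 3), σ.Injective ∧ s ≠ 0 ∧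
      ∀ k l, x k l = c l + b k + s * (if l = σ k then 1 else 0) := by
  have h0 : ∀ k, ∃ b p q, k ≠ 0 → p ≠ q ∧ ∀ l, x k l - x 0 l =
      b + (if l = p then 1 else 0) - (if l = q then 1 else 0) := fun k => by
    by_cases hk : k = 0
    · exact ⟨0, 0, 0, fun h => absurd hk h⟩
    · obtain ⟨b, p, q, h'⟩ := h k 0 hk
      exact ⟨b, p, q, fun _ => h'⟩
  choose b p q hpq using h0
  have share : ∀ j k, j ≠ 0 → k ≠ 0 → j ≠ k →
      (p j = p k ∧ q j ≠ q k) ∨ (p j ≠ p k ∧ q j = q k) ∨ (p j = q k ∧ q j = p k) := by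
    intro j k hj hk hjk
    obtain ⟨b', r, s, hrs, hx⟩ := h j k hjk
    refine share_of_difference (c := b j - b k) (b := b') (hpq j hj).1 (hpq k hk).1 hrs fun l => ?_
    rw [← hx]
    linear_combination -(hpq j hj).2 l + (hpq k hk).2 l
  have hne : ∀ k, k ≠ 0 → p k ≠ q k := fun k hk => (hpq k hk).1
  have star : (∀ j k, j ≠ 0 → k ≠ 0 → j ≠ k → p j = p k ∧ q j ≠ q k) ∨
      (∀ j k, j ≠ 0 → k ≠ 0 → j ≠ k → p j ≠ p k ∧ q j = q k) := by
    have third : ∀ j k : Fin 8, ∃ m, m ≠ 0 ∧ m ≠ j ∧ m ≠ k := by decide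
    have share' : ∀ j k, j ≠ 0 → k ≠ 0 → j ≠ k →
        (p j = p k ∧ q j ≠ q k) ∨ (p j ≠ p k ∧ q j = q k) := by
      intro j k hj hk hjk
      obtain ⟨m, hm, hmj, hmk⟩ := third j k
      have := share j k hj hk hjk
      have := share j m hj hm hmj.symm
      have := share k m hk hm hmk.symm
      have := hne j hj
      have := hne k hk
      have := hne m hm
      clear share hpq h
      grind
    by_cases h12 : p 1 = p 2
    · left
      have hall : ∀ k, k ≠ 0 → p k = p 1 := by
        intro k hk
        have a1 := share' 1 2 (by decide) (by decide) (by decide)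
        by_cases hk1 : k = 1
        · rw [hk1]
        by_cases hk2 : k = 2
        · rw [hk2, h12]
        have a2 := share' k 1 hk (by decide) hk1
        have a3 := share' k 2 hk (by decide) hk2
        clear share share' hpq h
        grind
      intro j k hj hk hjk
      have := share' j k hj hk hjk
      have := hall j hj
      have := hall k hk
      clear share share' hpq h
      grind
    · right
      have hall : ∀ k, k ≠ 0 → q k = q 1 := by
        intro k hk
        have a1 := share' 1 2 (by decide) (by decide) (by decide)
        by_cases hk1 : k = 1
        · rw [hk1]
        by_cases hk2 : k = 2
        · rw [hk2]
          clear share share' hpq h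
          grind
        have a2 := share' k 1 hk (by decide) hk1
        have a3 := share' k 2 hk (by decide) hk2
        clear share share' hpq h
        grind
      intro j k hj hk hjk
      have := share' j k hj hk hjk
      have := hall j hj
      have := hall k hk
      clear share share' hpq h
      grind
  rcases star with hs | hs
  · have hp : ∀ k, k ≠ 0 → p k = p 1 := fun k hk => by
      by_cases hk1 : k = 1
      · rw [hk1]
      · exact (hs k 1 hk (by decide) hk1).1
    refine ⟨fun k => if k = 0 then p 1 else q k, -1, fun k => if k = 0 then 0 else b k,
      fun l => x 0 l + if l = p 1 then 1 else 0, ?_, by decide, fun k l => ?_⟩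
    · intro j k hjk
      by_contra hne'
      by_cases hj : j = 0
      · have hk : k ≠ 0 := fun hk => hne' (hj.trans hk.symm)
        simp only [hj, hk, if_true, if_false] at hjk
        exact hne k hk (by rw [hp k hk, hjk])
      by_cases hk : k = 0
      · simp only [hj, hk, if_true, if_false] at hjk
        exact hne j hj (by rw [hp j hj, hjk])
      simp only [hj, hk, if_false] at hjk
      exact (hs j k hj hk hne').2 hjk
    · by_cases hk : k = 0
      · simp only [hk, if_true]
        ring
      · have := (hpq k hk).2 l
        rw [hp k hk] at this
        simp only [hk, if_false]
        linear_combination this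
  · have hq : ∀ k, k ≠ 0 → q k = q 1 := fun k hk => by
      by_cases hk1 : k = 1
      · rw [hk1]
      · exact (hs k 1 hk (by decide) hk1).2
    refine ⟨fun k => if k = 0 then q 1 else p k, 1, fun k => if k = 0 then 0 else b k,
      fun l => x 0 l - if l = q 1 then 1 else 0, ?_, by decide, fun k l => ?_⟩
    · intro j k hjk
      by_contra hne'
      by_cases hj : j = 0
      · have hk : k ≠ 0 := fun hk => hne' (hj.trans hk.symm)
        simp only [hj, hk, if_true, if_false] at hjk
        exact hne k hk (by rw [hq k hk, hjk])
      by_cases hk : k = 0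
      · simp only [hj, hk, if_true, if_false] at hjk
        exact hne j hj (by rw [hq j hj, hjk])
      simp only [hj, hk, if_false] at hjk
      exact (hs j k hj hk hne').1 hjk
    · by_cases hk : k = 0
      · simp [hk]
      · have := (hpq k hk).2 l
        rw [hq k hk] at this
        simp only [hk, if_false]
        linear_combination this

/-- There are no exponent matrices over `ZMod 3` and `ZMod 5` for which all differences of two rows
have the shape of a vanishing sum of eight fifteenth roots of unity. -/
lemma no_exponents (x : Fin 8 → Fin 8 → ZMod 3) (y : Fin 8 → Fin 8 → ZMod 5)
    (h : ∀ i k, i ≠ k → ∃ b a p q,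
      IsTripleQuintuple (fun l => x i l - x k l) (fun l => y i l - y k l) b a p q) : False := by
  obtain ⟨σ, s, β, c, hσ, hs, hx⟩ := exists_star x fun i k hik => by
    obtain ⟨b, a, p, q, ht⟩ := h i k hik
    exact ⟨b, p, q, ht.ne, ht.x_eq⟩
  let e : Fin 8 ≃ Fin 8 := Equiv.ofBijective σ (Finite.injective_iff_bijective.1 hσ)
  have hcard : ∀ P : Fin 8 → Prop, ∀ [DecidablePred P],
      (Finset.univ.filter fun l => P (σ l)).card = (Finset.univ.filter P).card := fun P _ =>
    Finset.card_equiv e (by simp [e])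
  refine no_array (fun j l => y j (σ l)) fun j k hjk => ?_
  obtain ⟨b, a, p, q, ht⟩ := h j k hjk
  have hd : ∀ l, β j - β k + s * (if l = σ j then 1 else 0) - s * (if l = σ k then 1 else 0) =
      b + (if l = p then 1 else 0) - (if l = q then 1 else 0) := fun l => by
    rw [← ht.x_eq, hx, hx]
    ring
  have hjk' : σ j ≠ σ k := fun h' => hjk (hσ h')
  obtain ⟨t, hmem⟩ : ∃ t, t ∉ ({σ j, σ k, p, q} : Finset (Fin 8)) := by
    by_contra! hall
    have h1 := Finset.card_le_card (fun t _ => hall t : (Finset.univ : Finset (Fin 8)) ⊆ _)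
    have h2 := Finset.card_le_four (a := σ j) (b := σ k) (c := p) (d := q)
    simp at h1
    omega
  simp only [Finset.mem_insert, Finset.mem_singleton, not_or] at hmem
  have hb : β j - β k = b := by simpa [hmem] using hd t
  have hspecial : ∀ l, l = σ j ∨ l = σ k → y j l - y k l = a := fun l hl => by
    have : l = p ∨ l = q := by
      by_contra! hne
      have h1 := hd l
      rcases hl with rfl | rfl
      · simp [hne, hjk', hb, hs] at h1
      · simp [hne, hjk'.symm, hb, hs] at h1
    rcases this with rfl | rfl
    · exact ht.y_left
    · exact ht.y_right
  refine ⟨a, hspecial _ (.inl rfl), hspecial _ (.inr rfl), ?_, fun c' hc' => ?_⟩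
  · rw [hcard fun l => y j l - y k l = a]
    exact ht.card_eq
  · rw [hcard fun l => y j l - y k l = c']
    exact ht.card_ne c' hc'

theorem no_BH_8_15 : ¬ ∃ H : Matrix (Fin 8) (Fin 8) ℂ, IsButson 15 H := by
  rintro ⟨H, hroot, hH⟩
  obtain ⟨ζ, h⟩ : ∃ ζ : ℂ, IsPrimitiveRoot ζ 15 :=
    ⟨_, Complex.isPrimitiveRoot_exp 15 (by norm_num)⟩
  have hex : ∀ i j, ∃ e : ZMod 15, ζ ^ e.val = H i j := fun i j => by
    obtain ⟨n, hn, he⟩ := h.eq_pow_of_pow_eq_one (hroot i j)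
    exact ⟨n, by rw [ZMod.val_natCast, Nat.mod_eq_of_lt hn, he]⟩
  choose e he using hex
  have hpow : ∀ n : ℕ, ζ ^ ((n : ZMod 15).val) = ζ ^ n := fun n => by
    rw [ZMod.val_natCast, ← pow_mod_orderOf ζ n, ← h.eq_orderOf]
  have hadd : ∀ a b : ZMod 15, ζ ^ (a + b).val = ζ ^ a.val * ζ ^ b.val := fun a b => by
    rw [← pow_add, ← hpow (a.val + b.val)]
    simp
  have hζ : starRingEnd ℂ ζ = ζ⁻¹ := by
    rw [Complex.inv_eq_conj (h.norm'_eq_one (by norm_num))]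
  have hsub : ∀ a b : ZMod 15, ζ ^ (a - b).val = ζ ^ a.val * starRingEnd ℂ (ζ ^ b.val) := by
    intro a b
    rw [map_pow, hζ, inv_pow, ← sub_add_cancel a b, hadd, sub_add_cancel,
      mul_inv_cancel_right₀ (pow_ne_zero _ (h.ne_zero (by norm_num)))]
  let f3 : ZMod 15 →+* ZMod 3 := ZMod.castHom (by norm_num) _
  let f5 : ZMod 15 →+* ZMod 5 := ZMod.castHom (by norm_num) _
  refine no_exponents (fun i l => f3 (e i l)) (fun i l => f5 (e i l)) fun i k hik => ?_
  simp only [← map_sub]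
  have hD : ∑ l, ζ ^ (e i l - e k l).val = 0 := by
    have := congrFun (congrFun hH i) k
    simp only [Matrix.mul_apply, Matrix.conjTranspose_apply, Matrix.smul_apply,
      Matrix.one_apply_ne hik, smul_zero] at this
    rw [← this]
    exact Finset.sum_congr rfl fun l _ => by rw [hsub, he, he]; rfl
  generalize hDD : (fun l => e i l - e k l) = D
  have hDl : ∀ l, e i l - e k l = D l := fun l => by rw [← hDD]
  simp only [hDl] at hD ⊢
  have hN : ∑ z, ((Finset.univ.filter fun l => D l = z).card : ℂ) * ζ ^ z.val = 0 := by
    rw [← hD, ← Finset.sum_fiberwise Finset.univ D]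
    refine Finset.sum_congr rfl fun z _ => ?_
    rw [Finset.sum_congr rfl (g := fun _ => ζ ^ z.val), Finset.sum_const, nsmul_eq_mul]
    intro l hl
    rw [(Finset.mem_filter.1 hl).2]
  refine exists_isTripleQuintuple _ _ fun u v => ?_
  have crt : ∀ z : ZMod 15, ∀ (u : ZMod 3) (v : ZMod 5),
      (ZMod.castHom (by norm_num : 3 ∣ 15) (ZMod 3) z = u ∧
        ZMod.castHom (by norm_num : 5 ∣ 15) (ZMod 5) z = v) ↔
      z = 10 * (u.val : ZMod 15) + 6 * (v.val : ZMod 15) := by decide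
  have key := add_eq_add_of_sum_eq_zero h _ hN u v
  have e1 := fun l => crt (D l) u v
  have e2 := fun l => crt (D l) 0 0
  have e3 := fun l => crt (D l) u 0
  have e4 := fun l => crt (D l) 0 v
  simp only [ZMod.val_zero, Nat.cast_zero, mul_zero, add_zero, zero_add] at e2 e3 e4
  simp only [← e1, ← e2, ← e3, ← e4] at key
  exact key
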